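/- Let (R, m) be a commutative Noetherian local ring with positive depth, let M and N be nonzero finitely generated Tor-independent R-modules, and let x ∈ m be regular on R and on M. Then there is an exact sequence 0 → Tor_2^{R/xR}(N/xN, M/xM) → Tor_1^R(N, R/xR) ⊗_{R/xR} (M/xM) → Tor_1^R(N, M/xM) → Tor_1^{R/xR}(N/xN, M/xM) → 0, and isomorphisms Tor_p^{R/xR}(N/xN, M/xM) ≅ Tor_{p-2}^{R/xR}(Tor_1^R(N, R/xR), M/xM) for all p ≥ 3. -/

import Mathlib

open CategoryTheory

universe u

/-- `Tor_i` over `R`, for bundled modules. -/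
noncomputable def torM (R : Type u) [CommRing R] (i : ℕ) (M N : ModuleCat.{u} R) :
    ModuleCat.{u} R :=
  ((Tor (ModuleCat.{u} R) i).obj M).obj N

/-- `Tor_i^R(M, N)` for unbundled modules. -/
noncomputable def torMod (R : Type u) [CommRing R] (i : ℕ)
    (M N : Type u) [AddCommGroup M] [Module R M] [AddCommGroup N] [Module R N] :
    ModuleCat.{u} R :=
  torM R i (ModuleCat.of R M) (ModuleCat.of R N)

/-- `M` and `N` are Tor-independent over `R`: `Tor_i^R(M,N) = 0` for all `i ≥ 1`. -/
def TorIndep (R : Type u) [CommRing R]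
    (M N : Type u) [AddCommGroup M] [Module R M] [AddCommGroup N] [Module R N] : Prop :=
  ∀ i : ℕ, 1 ≤ i → Subsingleton (torMod R i M N)

/-- `Ext^i_R(M, N)` for unbundled modules. -/
noncomputable def extMod (R : Type u) [CommRing R] (i : ℕ)
    (M N : Type u) [AddCommGroup M] [Module R M] [AddCommGroup N] [Module R N] :
    ModuleCat.{u} R :=
  ((Ext R (ModuleCat.{u} R) i).obj (Opposite.op (ModuleCat.of R M))).obj (ModuleCat.of R N)

/-- Depth of a module over a local ring: the least `i` with `Ext^i(k, M) ≠ 0`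
(and `⊤` if all such Ext vanish, e.g. for the zero module). -/
noncomputable def eDepth (R : Type u) [CommRing R] [IsLocalRing R]
    (M : Type u) [AddCommGroup M] [Module R M] : ℕ∞ :=
  sInf {n : ℕ∞ | ∃ i : ℕ, n = (i : ℕ∞) ∧
    Nontrivial (extMod R i (IsLocalRing.ResidueField R) M)}


open MonoidalCategory

section LongExactSequence

variable {R : Type u} [CommRing R]

/-- The map of complexes `A ⊗ P ⟶ B ⊗ P` induced by `f : A ⟶ B`. -/
noncomputable def tensorComplexMap {A B : ModuleCat.{u} R} (f : A ⟶ B)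
    (P : ChainComplex (ModuleCat.{u} R) ℕ) :
    (((tensoringLeft _).obj A).mapHomologicalComplex (ComplexShape.down ℕ)).obj P ⟶
      (((tensoringLeft _).obj B).mapHomologicalComplex (ComplexShape.down ℕ)).obj P :=
  (NatTrans.mapHomologicalComplex ((tensoringLeft _).map f) (ComplexShape.down ℕ)).app P

/-- The short complex of complexes `A ⊗ P ⟶ B ⊗ P ⟶ C ⊗ P`. -/
noncomputable def tensorShortComplex (S : ShortComplex (ModuleCat.{u} R))
    (P : ChainComplex (ModuleCat.{u} R) ℕ) :
    ShortComplex (ChainComplex (ModuleCat.{u} R) ℕ) :=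
  ShortComplex.mk (tensorComplexMap S.f P) (tensorComplexMap S.g P) (by
    ext n : 1
    change (S.f ▷ P.X n) ≫ (S.g ▷ P.X n) = 0
    rw [← comp_whiskerRight, S.zero]
    simp)

theorem tensorShortComplex_shortExact {S : ShortComplex (ModuleCat.{u} R)} (hS : S.ShortExact)
    (P : ChainComplex (ModuleCat.{u} R) ℕ) (hP : ∀ n, Projective (P.X n)) :
    (tensorShortComplex S P).ShortExact := by
  refine HomologicalComplex.shortExact_of_degreewise_shortExact _ fun n => ?_
  have : Module.Projective R (P.X n) := (IsProjective.iff_projective _).2 (hP n)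
  change (S.map (tensorRight (P.X n))).ShortExact
  exact hS.map_of_exact _

/-- `Tor` computed by a projective resolution of the second variable. -/
noncomputable def torIso (n : ℕ) (A : ModuleCat.{u} R) {X : ModuleCat.{u} R}
    (P : ProjectiveResolution X) :
    torM R n A X ≅ HomologicalComplex.homology
      ((((tensoringLeft _).obj A).mapHomologicalComplex (ComplexShape.down ℕ)).obj P.complex) n :=
  P.isoLeftDerivedObj ((tensoringLeft _).obj A) n

instance (A : ModuleCat.{u} R) :
    Limits.PreservesFiniteColimits ((tensoringLeft (ModuleCat.{u} R)).obj A) :=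
  inferInstanceAs (Limits.PreservesFiniteColimits (tensorLeft A))

/-- `H₀(A ⊗ P) ≅ A ⊗ X` for a projective resolution `P` of `X`. -/
noncomputable def tensorHomologyZeroIso (A : ModuleCat.{u} R) {X : ModuleCat.{u} R}
    (P : ProjectiveResolution X) :
    HomologicalComplex.homology
      ((((tensoringLeft _).obj A).mapHomologicalComplex (ComplexShape.down ℕ)).obj P.complex) 0 ≅
      A ⊗ X :=
  ChainComplex.isoHomologyι₀ _ ≪≫ asIso (P.fromLeftDerivedZero' ((tensoringLeft _).obj A))

theorem tensorHomologyZeroIso_naturality {A B : ModuleCat.{u} R} (f : A ⟶ B)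
    {X : ModuleCat.{u} R} (P : ProjectiveResolution X) :
    HomologicalComplex.homologyMap (tensorComplexMap f P.complex) 0 ≫
      (tensorHomologyZeroIso B P).hom = (tensorHomologyZeroIso A P).hom ≫ f ▷ X := by
  have key : HomologicalComplex.opcyclesMap (tensorComplexMap f P.complex) 0 ≫
      P.fromLeftDerivedZero' ((tensoringLeft _).obj B) =
      P.fromLeftDerivedZero' ((tensoringLeft _).obj A) ≫ f ▷ X := by
    rw [← cancel_epi (HomologicalComplex.pOpcycles _ _),
      HomologicalComplex.p_opcyclesMap_assoc, P.pOpcycles_comp_fromLeftDerivedZero',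
      P.pOpcycles_comp_fromLeftDerivedZero'_assoc]
    exact (whisker_exchange f (P.π.f 0)).symm
  simp only [tensorHomologyZeroIso, Iso.trans_hom, asIso_hom, Category.assoc]
  rw [← key]
  exact HomologicalComplex.homologyι_naturality_assoc _ _ _

theorem subsingleton_torMod_succ_of_flat (n : ℕ) (F X : Type u) [AddCommGroup F] [Module R F]
    [AddCommGroup X] [Module R X] [Module.Flat R F] : Subsingleton (torMod R (n + 1) F X) := by
  let P := projectiveResolution (ModuleCat.of R X)
  have : Limits.PreservesFiniteLimits ((tensoringLeft (ModuleCat.{u} R)).obj (ModuleCat.of R F)) :=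
    inferInstanceAs (Limits.PreservesFiniteLimits (tensorLeft (ModuleCat.of R F)))
  have h : HomologicalComplex.ExactAt ((((tensoringLeft _).obj
      (ModuleCat.of R F)).mapHomologicalComplex (ComplexShape.down ℕ)).obj P.complex) (n + 1) :=
    ShortComplex.Exact.map (P.complex_exactAt_succ n) ((tensoringLeft _).obj (ModuleCat.of R F))
  exact ModuleCat.subsingleton_of_isZero (h.isZero_homology.of_iso (torIso (n + 1) _ P))

theorem isZero_of_subsingleton_torMod {n : ℕ} {A X : Type u} [AddCommGroup A] [Module R A]
    [AddCommGroup X] [Module R X] (h : Subsingleton (torMod R n A X)) :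
    Limits.IsZero (torMod R n A X) :=
  ModuleCat.isZero_of_subsingleton _

variable {A B C : Type u} [AddCommGroup A] [Module R A] [AddCommGroup B] [Module R B]
  [AddCommGroup C] [Module R C]

/-- Unbundled short exact sequences give short exact sequences in `ModuleCat`. -/
theorem exists_shortExact_of_linearMap {f : A →ₗ[R] B} {g : B →ₗ[R] C}
    (hf : Function.Injective f) (hfg : Function.Exact f g) (hg : Function.Surjective g) :
    ∃ w : ModuleCat.ofHom f ≫ ModuleCat.ofHom g = 0,
      (ShortComplex.mk (ModuleCat.ofHom f) (ModuleCat.ofHom g) w).ShortExact := by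
  refine ⟨by ext a; exact hfg.apply_apply_eq_zero a, ?_⟩
  have : Mono (ModuleCat.ofHom f) := (ModuleCat.mono_iff_injective _).2 hf
  have : Epi (ModuleCat.ofHom g) := (ModuleCat.epi_iff_surjective _).2 hg
  exact ⟨(ShortComplex.ShortExact.moduleCat_exact_iff_function_exact _).2 hfg⟩

/-- Dimension shifting in the first variable. -/
theorem nonempty_torMod_equiv_of_exact {f : A →ₗ[R] B} {g : B →ₗ[R] C}
    (hf : Function.Injective f) (hfg : Function.Exact f g) (hg : Function.Surjective g)
    (X : Type u) [AddCommGroup X] [Module R X] (n : ℕ)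
    (h₂ : Subsingleton (torMod R (n + 2) B X)) (h₁ : Subsingleton (torMod R (n + 1) B X)) :
    Nonempty (torMod R (n + 2) C X ≃ₗ[R] torMod R (n + 1) A X) := by
  obtain ⟨w, hS⟩ := exists_shortExact_of_linearMap hf hfg hg
  let P := projectiveResolution (ModuleCat.of R X)
  have hT := tensorShortComplex_shortExact hS P.complex fun n => P.projective n
  refine ⟨(torIso (n + 2) _ P ≪≫ hT.δIso (n + 2) (n + 1) rfl ?_ ?_ ≪≫
    (torIso (n + 1) _ P).symm).toLinearEquiv⟩
  · exact (isZero_of_subsingleton_torMod h₂).of_iso (torIso (n + 2) _ P).symm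
  · exact (isZero_of_subsingleton_torMod h₁).of_iso (torIso (n + 1) _ P).symm

/-- The end of the long exact sequence of `Tor` in the first variable. -/
theorem exists_torMod_one_connecting {f : A →ₗ[R] B} {g : B →ₗ[R] C}
    (hf : Function.Injective f) (hfg : Function.Exact f g) (hg : Function.Surjective g)
    (X : Type u) [AddCommGroup X] [Module R X] (h : Subsingleton (torMod R 1 B X)) :
    ∃ δ : torMod R 1 C X →ₗ[R] TensorProduct R A X,
      Function.Injective δ ∧ Function.Exact δ (f.rTensor X) := by
  obtain ⟨w, hS⟩ := exists_shortExact_of_linearMap hf hfg hg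
  let P := projectiveResolution (ModuleCat.of R X)
  have hT := tensorShortComplex_shortExact hS P.complex fun n => P.projective n
  have hδ : Mono (hT.δ 1 0 rfl) := hT.mono_δ 1 0 rfl
    ((isZero_of_subsingleton_torMod h).of_iso (torIso 1 _ P).symm)
  have hex := (ShortComplex.ShortExact.moduleCat_exact_iff_function_exact _).1
    (hT.homology_exact₁ 1 0 rfl)
  have hnat := tensorHomologyZeroIso_naturality (ModuleCat.ofHom f) P
  let e₃ := (torIso 1 (ModuleCat.of R C) P).toLinearEquiv
  let e₁ := (tensorHomologyZeroIso (ModuleCat.of R A) P).toLinearEquiv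
  let e₂ := (tensorHomologyZeroIso (ModuleCat.of R B) P).toLinearEquiv
  have hnat' : ∀ y, e₂ ((HomologicalComplex.homologyMap
      (tensorComplexMap (ModuleCat.ofHom f) P.complex) 0).hom y) = f.rTensor X (e₁ y) :=
    fun y => LinearMap.congr_fun (congrArg ModuleCat.Hom.hom hnat) y
  refine ⟨e₁.toLinearMap ∘ₗ (hT.δ 1 0 rfl).hom ∘ₗ e₃.toLinearMap, ?_, ?_⟩
  · exact e₁.injective.comp (((ModuleCat.mono_iff_injective _).1 hδ).comp e₃.injective)
  · intro y
    obtain ⟨y, rfl⟩ := e₁.surjective y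
    rw [← hnat', LinearEquiv.map_eq_zero_iff]
    refine (hex y).trans ⟨?_, ?_⟩
    · rintro ⟨z, rfl⟩
      exact ⟨e₃.symm z, congrArg (fun t => e₁ ((hT.δ 1 0 rfl).hom t)) (e₃.apply_symm_apply z)⟩
    · rintro ⟨z, hz⟩
      exact ⟨e₃ z, e₁.injective hz⟩

end LongExactSequence

section Symmetry

variable {R : Type u} [CommRing R]

theorem subsingleton_torMod_one_iff {A B C : Type u} [AddCommGroup A] [Module R A]
    [AddCommGroup B] [Module R B] [AddCommGroup C] [Module R C] [Module.Flat R B]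
    {f : A →ₗ[R] B} {g : B →ₗ[R] C}
    (hf : Function.Injective f) (hfg : Function.Exact f g) (hg : Function.Surjective g)
    (X : Type u) [AddCommGroup X] [Module R X] :
    Subsingleton (torMod R 1 C X) ↔ Function.Injective (f.rTensor X) := by
  obtain ⟨δ, hδ, hex⟩ := exists_torMod_one_connecting hf hfg hg X
    (subsingleton_torMod_succ_of_flat 0 B X)
  refine ⟨fun h => ?_, fun h => ⟨fun a b => hδ (h ?_)⟩⟩
  · rw [injective_iff_map_eq_zero]
    intro y hy
    obtain ⟨z, rfl⟩ := (hex y).1 hy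
    rw [Subsingleton.elim z 0, map_zero]
  · rw [hex.apply_apply_eq_zero, hex.apply_apply_eq_zero]

variable (R) in
/-- Every module is the quotient of a free module. -/
theorem exists_free_presentation (A : Type u) [AddCommGroup A] [Module R A] :
    ∃ (L F : Type u) (_ : AddCommGroup L) (_ : Module R L) (_ : AddCommGroup F) (_ : Module R F)
      (i : L →ₗ[R] F) (p : F →ₗ[R] A), Module.Free R F ∧ Function.Injective i ∧
        Function.Exact i p ∧ Function.Surjective p :=
  ⟨LinearMap.ker (Finsupp.linearCombination R (id : A → A)), A →₀ R, inferInstance, inferInstance,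
    inferInstance, inferInstance, Submodule.subtype _, Finsupp.linearCombination R id,
    inferInstance, Submodule.subtype_injective _, LinearMap.exact_subtype_ker_map _,
    Finsupp.linearCombination_id_surjective R A⟩

theorem nonempty_torMod_equiv_of_flat {L F A : Type u} [AddCommGroup L] [Module R L]
    [AddCommGroup F] [Module R F] [AddCommGroup A] [Module R A] [Module.Flat R F]
    {i : L →ₗ[R] F} {p : F →ₗ[R] A}
    (hi : Function.Injective i) (hip : Function.Exact i p) (hp : Function.Surjective p)
    (X : Type u) [AddCommGroup X] [Module R X] (n : ℕ) :
    Nonempty (torMod R (n + 2) A X ≃ₗ[R] torMod R (n + 1) L X) :=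
  nonempty_torMod_equiv_of_exact hi hip hp X n (subsingleton_torMod_succ_of_flat _ _ _)
    (subsingleton_torMod_succ_of_flat _ _ _)

theorem subsingleton_torMod_shift_iff {L F A : Type u} [AddCommGroup L] [Module R L]
    [AddCommGroup F] [Module R F] [AddCommGroup A] [Module R A] [Module.Flat R F]
    {i : L →ₗ[R] F} {p : F →ₗ[R] A}
    (hi : Function.Injective i) (hip : Function.Exact i p) (hp : Function.Surjective p)
    (X : Type u) [AddCommGroup X] [Module R X] (n : ℕ) :
    Subsingleton (torMod R (n + 1) L X) ↔ Subsingleton (torMod R (n + 2) A X) :=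
  let ⟨e⟩ := nonempty_torMod_equiv_of_flat hi hip hp X n
  e.toEquiv.subsingleton_congr.symm

theorem rTensor_injective_iff_lTensor_injective {A B : Type u} [AddCommGroup A] [Module R A]
    [AddCommGroup B] [Module R B] (f : A →ₗ[R] B) (X : Type u) [AddCommGroup X] [Module R X] :
    Function.Injective (f.rTensor X) ↔ Function.Injective (f.lTensor X) := by
  rw [← LinearMap.comm_comp_rTensor_comp_comm_eq]
  simp

theorem rTensor_lTensor_apply {P Q P' Q' : Type*} [AddCommGroup P] [Module R P]
    [AddCommGroup Q] [Module R Q] [AddCommGroup P'] [Module R P'] [AddCommGroup Q'] [Module R Q']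
    (f : P →ₗ[R] Q) (g : P' →ₗ[R] Q') (t : TensorProduct R P P') :
    f.rTensor Q' (g.lTensor P t) = g.lTensor Q (f.rTensor P' t) := by
  rw [← LinearMap.comp_apply, ← LinearMap.comp_apply, LinearMap.lTensor_comp_rTensor,
    LinearMap.rTensor_comp_lTensor]

/-- The snake-lemma form of the symmetry of `Tor₁`. -/
theorem rTensor_injective_of_lTensor_injective {L F A L' F' B : Type*}
    [AddCommGroup L] [Module R L] [AddCommGroup F] [Module R F] [AddCommGroup A] [Module R A]
    [AddCommGroup L'] [Module R L'] [AddCommGroup F'] [Module R F'] [AddCommGroup B] [Module R B]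
    [Module.Flat R F] [Module.Flat R F']
    {i : L →ₗ[R] F} {p : F →ₗ[R] A} {i' : L' →ₗ[R] F'} {p' : F' →ₗ[R] B}
    (hi : Function.Injective i) (hip : Function.Exact i p) (hp : Function.Surjective p)
    (hip' : Function.Exact i' p') (hp' : Function.Surjective p')
    (h : Function.Injective (i'.lTensor A)) : Function.Injective (i.rTensor B) := by
  rw [injective_iff_map_eq_zero]
  intro z hz
  obtain ⟨w, rfl⟩ := LinearMap.lTensor_surjective L hp' z
  rw [rTensor_lTensor_apply] at hz
  obtain ⟨v, hv⟩ := (lTensor_exact F hip' hp' _).1 hz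
  have hv0 : p.rTensor L' v = 0 := h <| by
    rw [map_zero, ← rTensor_lTensor_apply, hv]
    exact (rTensor_exact F' hip hp).apply_apply_eq_zero w
  obtain ⟨u, rfl⟩ := (rTensor_exact L' hip hp _).1 hv0
  rw [← rTensor_lTensor_apply] at hv
  rw [← Module.Flat.rTensor_preserves_injective_linearMap i hi hv]
  exact (lTensor_exact L hip' hp').apply_apply_eq_zero u

theorem subsingleton_torMod_one_symm {A B : Type u} [AddCommGroup A] [Module R A]
    [AddCommGroup B] [Module R B] (h : Subsingleton (torMod R 1 A B)) :
    Subsingleton (torMod R 1 B A) := by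
  obtain ⟨L, F, _, _, _, _, i, p, _, hi, hip, hp⟩ := exists_free_presentation R A
  obtain ⟨L', F', _, _, _, _, i', p', _, hi', hip', hp'⟩ := exists_free_presentation R B
  rw [subsingleton_torMod_one_iff hi hip hp, rTensor_injective_iff_lTensor_injective] at h
  rw [subsingleton_torMod_one_iff hi' hip' hp']
  exact rTensor_injective_of_lTensor_injective hi' hip' hp' hip hp h

theorem subsingleton_torMod_right_shift {A : Type u} [AddCommGroup A] [Module R A]
    {L' F' B : Type u} [AddCommGroup L'] [Module R L'] [AddCommGroup F'] [Module R F']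
    [AddCommGroup B] [Module R B] [Module.Flat R F']
    {i' : L' →ₗ[R] F'} {p' : F' →ₗ[R] B}
    (hi' : Function.Injective i') (hip' : Function.Exact i' p') (hp' : Function.Surjective p')
    (n : ℕ) (h : Subsingleton (torMod R (n + 2) A B)) :
    Subsingleton (torMod R (n + 1) A L') := by
  induction n generalizing A with
  | zero =>
    obtain ⟨L, F, _, _, _, _, i, p, _, hi, hip, hp⟩ := exists_free_presentation R A
    have h₁ := subsingleton_torMod_one_symm ((subsingleton_torMod_shift_iff hi hip hp B 0).2 h)
    rw [subsingleton_torMod_one_iff hi' hip' hp', rTensor_injective_iff_lTensor_injective] at h₁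
    rw [subsingleton_torMod_one_iff hi hip hp]
    have h₂ := (Module.Flat.rTensor_preserves_injective_linearMap (M := F') i hi).comp h₁
    rw [← LinearMap.coe_comp, LinearMap.rTensor_comp_lTensor, ← LinearMap.lTensor_comp_rTensor,
      LinearMap.coe_comp] at h₂
    exact h₂.of_comp
  | succ n ih =>
    obtain ⟨L, F, _, _, _, _, i, p, _, hi, hip, hp⟩ := exists_free_presentation R A
    rw [← subsingleton_torMod_shift_iff hi hip hp] at h ⊢
    exact ih h

/-- Vanishing of `Tor` is symmetric in the two variables. -/
theorem subsingleton_torMod_symm (n : ℕ) {A B : Type u} [AddCommGroup A] [Module R A]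
    [AddCommGroup B] [Module R B] (h : Subsingleton (torMod R (n + 1) A B)) :
    Subsingleton (torMod R (n + 1) B A) := by
  induction n generalizing B with
  | zero => exact subsingleton_torMod_one_symm h
  | succ n ih =>
    obtain ⟨L, F, _, _, _, _, i, p, _, hi, hip, hp⟩ := exists_free_presentation R B
    rw [← subsingleton_torMod_shift_iff hi hip hp]
    exact ih (subsingleton_torMod_right_shift hi hip hp n h)

end Symmetry

section ChangeOfRings

open TensorProduct

variable {R : Type u} [CommRing R] (S : Type u) [CommRing S] [Algebra R S]

/-- The isomorphism `(S ⊗ L) ⊗_S X ≅ L ⊗ X` for an `S`-module `X`. -/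
noncomputable def baseChangeTensorEquiv (L X : Type u) [AddCommGroup L] [Module R L]
    [AddCommGroup X] [Module R X] [Module S X] [IsScalarTower R S X] :
    (S ⊗[R] L) ⊗[S] X ≃+ L ⊗[R] X :=
  (TensorProduct.comm S (S ⊗[R] L) X).toAddEquiv.trans
    ((AlgebraTensorModule.cancelBaseChange R S S X L).toAddEquiv.trans
      (TensorProduct.comm R X L).toAddEquiv)

variable {S}

theorem baseChangeTensorEquiv_tmul {L X : Type u} [AddCommGroup L] [Module R L]
    [AddCommGroup X] [Module R X] [Module S X] [IsScalarTower R S X] (s : S) (l : L) (y : X) :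
    baseChangeTensorEquiv S L X ((s ⊗ₜ[R] l) ⊗ₜ[S] y) = l ⊗ₜ (s • y) :=
  rfl

theorem baseChangeTensorEquiv_naturality {L F X : Type u} [AddCommGroup L] [Module R L]
    [AddCommGroup F] [Module R F] [AddCommGroup X] [Module R X] [Module S X] [IsScalarTower R S X]
    (f : L →ₗ[R] F) (t : (S ⊗[R] L) ⊗[S] X) :
    baseChangeTensorEquiv S F X ((f.baseChange S).rTensor X t) =
      f.rTensor X (baseChangeTensorEquiv S L X t) := by
  induction t with
  | zero => simp
  | add t t' h h' => simp only [map_add, h, h']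
  | tmul t y =>
    induction t with
    | zero => simp
    | add t t' h h' => simp only [add_tmul, map_add, h, h']
    | tmul s l =>
      simp only [LinearMap.rTensor_tmul, LinearMap.baseChange_tmul, baseChangeTensorEquiv_tmul]

theorem rTensor_baseChange_injective_iff {L F X : Type u} [AddCommGroup L] [Module R L]
    [AddCommGroup F] [Module R F] [AddCommGroup X] [Module R X] [Module S X] [IsScalarTower R S X]
    (f : L →ₗ[R] F) :
    Function.Injective ((f.baseChange S).rTensor X) ↔ Function.Injective (f.rTensor X) := by
  have h : baseChangeTensorEquiv S F X ∘ (f.baseChange S).rTensor X =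
      f.rTensor X ∘ baseChangeTensorEquiv S L X :=
    funext fun t => baseChangeTensorEquiv_naturality f t
  rw [← EquivLike.comp_injective _ (baseChangeTensorEquiv S F X), h,
    EquivLike.injective_comp]

theorem baseChange_exact {L F A : Type u} [AddCommGroup L] [Module R L]
    [AddCommGroup F] [Module R F] [AddCommGroup A] [Module R A]
    {i : L →ₗ[R] F} {p : F →ₗ[R] A} (hip : Function.Exact i p) (hp : Function.Surjective p) :
    Function.Exact (i.baseChange S) (p.baseChange S) :=
  lTensor_exact S hip hp

/-- If `L` is Tor-independent of the `R`-algebra `S`, then vanishing of `Tor` over `R` against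
an `S`-module is inherited by the base change of `L`. -/
theorem subsingleton_torMod_baseChange {X : Type u} [AddCommGroup X] [Module R X] [Module S X]
    [IsScalarTower R S X] (n : ℕ) {L : Type u} [AddCommGroup L] [Module R L]
    (hL : ∀ k, Subsingleton (torMod R (k + 1) L S)) (h : Subsingleton (torMod R (n + 1) L X)) :
    Subsingleton (torMod S (n + 1) (S ⊗[R] L) X) := by
  induction n generalizing L with
  | zero =>
    obtain ⟨L', F, _, _, _, _, i, p, _, hi, hip, hp⟩ := exists_free_presentation R L
    have hS := (rTensor_injective_iff_lTensor_injective i S).1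
      ((subsingleton_torMod_one_iff hi hip hp S).1 (hL 0))
    rw [subsingleton_torMod_one_iff hi hip hp] at h
    rw [subsingleton_torMod_one_iff (f := i.baseChange S) (g := p.baseChange S) hS
      (baseChange_exact hip hp) (LinearMap.lTensor_surjective S hp)]
    exact (rTensor_baseChange_injective_iff i).2 h
  | succ n ih =>
    obtain ⟨L', F, _, _, _, _, i, p, _, hi, hip, hp⟩ := exists_free_presentation R L
    have hS := (rTensor_injective_iff_lTensor_injective i S).1
      ((subsingleton_torMod_one_iff hi hip hp S).1 (hL 0))
    rw [← subsingleton_torMod_shift_iff hi hip hp] at h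
    rw [← subsingleton_torMod_shift_iff (i := i.baseChange S) (p := p.baseChange S) hS
      (baseChange_exact hip hp) (LinearMap.lTensor_surjective S hp)]
    exact ih (fun k => (subsingleton_torMod_shift_iff hi hip hp S k).2 (hL (k + 1))) h

/-- If `f : K → L` has cokernel `q : L → Z`, a map `d : Z → D` induces the exact sequence
`K → ker (d ∘ q) → ker d → 0`, where `i` and `j` realise the two kernels. -/
theorem exists_exact_kernel_sequence {K L Z D V W : Type*} [AddCommGroup K] [AddCommGroup L]
    [AddCommGroup Z] [AddCommMonoid D] [AddCommGroup V] [AddCommGroup W]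
    {f : K →+ L} {q : L →+ Z} {d : Z →+ D} {i : V →+ L} {j : W →+ Z}
    (hfq : Function.Exact f q) (hq : Function.Surjective q) (hi : Function.Injective i)
    (hid : Function.Exact i (d.comp q)) (hj : Function.Injective j) (hjd : Function.Exact j d) :
    ∃ (g : K →+ V) (h : V →+ W), (∀ k, i (g k) = f k) ∧ Function.Exact g h ∧
      Function.Surjective h := by
  have hg : ∀ k, ∃ v, i v = f k := fun k =>
    (hid (f k)).1 (by rw [AddMonoidHom.comp_apply, hfq.apply_apply_eq_zero, map_zero])
  choose g hg using hg
  have hh : ∀ v, ∃ w, j w = q (i v) := fun v => (hjd _).1 (hid.apply_apply_eq_zero v)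
  choose h hh using hh
  refine ⟨AddMonoidHom.mk' g fun a b => hi ?_, AddMonoidHom.mk' h fun a b => hj ?_, hg, ?_, ?_⟩
  · simp only [hg, map_add]
  · simp only [hh, map_add]
  · intro v
    change h v = 0 ↔ ∃ k, g k = v
    rw [← hj.eq_iff, hh, map_zero]
    refine (hfq _).trans (exists_congr fun k => ?_)
    rw [← hg, hi.eq_iff]
  · intro w
    obtain ⟨l, hl⟩ := hq (j w)
    obtain ⟨v, rfl⟩ := (hid l).1 (by rw [AddMonoidHom.comp_apply, hl, hjd.apply_apply_eq_zero])
    exact ⟨v, hj ((hh v).trans hl)⟩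

/-- Every linear map factors as a surjection followed by an injection. -/
theorem exists_image_factorization {L F : Type u} [AddCommGroup L] [Module R L]
    [AddCommGroup F] [Module R F] (f : L →ₗ[R] F) :
    ∃ (Z : Type u) (_ : AddCommGroup Z) (_ : Module R Z) (q : L →ₗ[R] Z) (j : Z →ₗ[R] F),
      Function.Surjective q ∧ Function.Injective j ∧ j ∘ₗ q = f :=
  ⟨LinearMap.range f, inferInstance, inferInstance, f.rangeRestrict, Submodule.subtype _,
    LinearMap.surjective_rangeRestrict f, Submodule.subtype_injective _, rfl⟩

/-- The low-degree exact sequence and the isomorphisms coming from the change-of-rings spectral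
sequence for `Tor` when `Tor^R` against `S` and against `X` vanishes in degrees at least two. -/
theorem exists_changeOfRings_exact_sequence (hRS : Function.Surjective (algebraMap R S))
    {N : Type u} [AddCommGroup N] [Module R N] {N' : Type u} [AddCommGroup N'] [Module S N']
    (e : S ⊗[R] N ≃ₗ[S] N') {X : Type u} [AddCommGroup X] [Module R X] [Module S X]
    [IsScalarTower R S X] [Module S (torMod R 1 N S)] [IsScalarTower R S (torMod R 1 N S)]
    (hS : ∀ n, Subsingleton (torMod R (n + 2) N S))
    (hX : ∀ n, Subsingleton (torMod R (n + 2) N X)) :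
    (∃ (f : torMod S 2 N' X →+ torMod R 1 N S ⊗[S] X) (g : torMod R 1 N S ⊗[S] X →+ torMod R 1 N X)
      (h : torMod R 1 N X →+ torMod S 1 N' X), Function.Injective f ∧ Function.Exact f g ∧
        Function.Exact g h ∧ Function.Surjective h) ∧
    ∀ p : ℕ, Nonempty (torMod S (p + 3) N' X ≃+ torMod S (p + 1) (torMod R 1 N S) X) := by
  obtain ⟨L, F, _, _, _, _, i, p, _, hi, hip, hp⟩ := exists_free_presentation R N
  have hLS (n) := (subsingleton_torMod_shift_iff hi hip hp S n).2 (hS n)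
  have hLX (n) := (subsingleton_torMod_shift_iff hi hip hp X n).2 (hX n)
  have hSL (n) := subsingleton_torMod_baseChange n hLS (hLX n)
  -- the two short exact sequences `0 → Tor₁(N, S) → S ⊗ L → Z → 0` and `0 → Z → S ⊗ F → N' → 0`
  obtain ⟨Z, _, _, q, j, hq, hj, hjq⟩ := exists_image_factorization (i.baseChange S)
  obtain ⟨δ, hδ, hδi⟩ := exists_torMod_one_connecting hi hip hp S
    (subsingleton_torMod_succ_of_flat 0 F S)
  let κ : torMod R 1 N S →ₗ[S] S ⊗[R] L :=
    ((TensorProduct.comm R L S).toLinearMap ∘ₗ δ).extendScalarsOfSurjective hRS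
  have hκ (t) : κ t = TensorProduct.comm R L S (δ t) := rfl
  have hκi : Function.Injective κ := (TensorProduct.comm R L S).injective.comp hδ
  have hκq : Function.Exact κ q := by
    intro t
    obtain ⟨t, rfl⟩ := (TensorProduct.comm R L S).surjective t
    have hcomm : (i.baseChange S).restrictScalars R ∘ₗ (TensorProduct.comm R L S).toLinearMap =
        (TensorProduct.comm R F S).toLinearMap ∘ₗ i.rTensor S := TensorProduct.ext' fun _ _ => rfl
    have hqt : j (q (TensorProduct.comm R L S t)) =
        TensorProduct.comm R F S (i.rTensor S t) :=
      (LinearMap.congr_fun hjq _).trans (LinearMap.congr_fun hcomm t)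
    rw [← map_eq_zero_iff j hj, hqt, LinearEquiv.map_eq_zero_iff]
    refine (hδi t).trans (exists_congr fun y => ?_)
    rw [hκ, (TensorProduct.comm R L S).injective.eq_iff]
  let g : S ⊗[R] F →ₗ[S] N' := e.toLinearMap ∘ₗ p.baseChange S
  have hjg : Function.Exact j g := by
    intro t
    rw [LinearMap.comp_apply, LinearEquiv.coe_coe, LinearEquiv.map_eq_zero_iff,
      baseChange_exact hip hp t, ← hjq, LinearMap.coe_comp, hq.range_comp]
  have hg : Function.Surjective g := e.surjective.comp (LinearMap.lTensor_surjective S hp)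
  obtain ⟨α, hα, hακ⟩ := exists_torMod_one_connecting hκi hκq hq X (hSL 0)
  obtain ⟨β, hβ, hβi⟩ := exists_torMod_one_connecting hi hip hp X
    (subsingleton_torMod_succ_of_flat 0 F X)
  obtain ⟨γ, hγ, hγj⟩ := exists_torMod_one_connecting hj hjg hg X
    (subsingleton_torMod_succ_of_flat 0 _ X)
  obtain ⟨ε⟩ := nonempty_torMod_equiv_of_flat hj hjg hg X 0
  refine ⟨?_, fun n => ?_⟩
  · let eL := baseChangeTensorEquiv (R := R) S L X
    let f : torMod R 1 N S ⊗[S] X →+ (S ⊗[R] L) ⊗[S] X := (κ.rTensor X).toAddMonoidHom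
    let q₁ : (S ⊗[R] L) ⊗[S] X →+ Z ⊗[S] X := (q.rTensor X).toAddMonoidHom
    let d : Z ⊗[S] X →+ (S ⊗[R] F) ⊗[S] X := (j.rTensor X).toAddMonoidHom
    let γ₁ : torMod S 1 N' X →+ Z ⊗[S] X := γ.toAddMonoidHom
    let β₁ : torMod R 1 N X →+ (S ⊗[R] L) ⊗[S] X := eL.symm.toAddMonoidHom.comp β.toAddMonoidHom
    have hβ₁ : Function.Injective β₁ := eL.symm.injective.comp hβ
    have hβq : Function.Exact β₁ (d.comp q₁) := by
      intro t
      have hqt : d.comp q₁ t = (i.baseChange S).rTensor X t :=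
        hjq ▸ (LinearMap.rTensor_comp_apply X j q t).symm
      rw [hqt, ← map_eq_zero_iff (baseChangeTensorEquiv (R := R) S F X) (AddEquiv.injective _),
        baseChangeTensorEquiv_naturality]
      exact (hβi _).trans (exists_congr fun y => eL.symm_apply_eq.symm)
    have hfq : Function.Exact f q₁ := rTensor_exact X hκq hq
    have hq₁ : Function.Surjective q₁ := LinearMap.rTensor_surjective X hq
    have hγ₁ : Function.Injective γ₁ := hγ
    have hγd : Function.Exact γ₁ d := hγj
    obtain ⟨g, h, hgf, hgh, hh⟩ := exists_exact_kernel_sequence (K := torMod R 1 N S ⊗[S] X)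
      (L := (S ⊗[R] L) ⊗[S] X) (Z := Z ⊗[S] X) (D := (S ⊗[R] F) ⊗[S] X) (V := torMod R 1 N X)
      (W := torMod S 1 N' X) (f := f) (q := q₁) (d := d) (i := β₁) (j := γ₁)
      hfq hq₁ hβ₁ hβq hγ₁ hγd
    refine ⟨α.toAddMonoidHom.comp ε.toAddEquiv.toAddMonoidHom, g, h, hα.comp ε.injective, ?_, hgh,
      hh⟩
    intro t
    rw [← map_eq_zero_iff β₁ hβ₁, hgf]
    exact (hακ t).trans (ε.surjective.exists (p := fun y => α y = t))
  · obtain ⟨a⟩ := nonempty_torMod_equiv_of_flat hj hjg hg X (n + 1)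
    obtain ⟨b⟩ := nonempty_torMod_equiv_of_exact hκi hκq hq X n (hSL (n + 1)) (hSL n)
    exact ⟨(a.trans b).toAddEquiv⟩

end ChangeOfRings

theorem exact_lsmul_mkQ {R M : Type*} [CommRing R] [AddCommGroup M] [Module R M] (x : R) :
    Function.Exact (LinearMap.lsmul R M x)
      (Submodule.mkQ (Ideal.span {x} • ⊤ : Submodule R M)) := by
  rw [LinearMap.exact_iff, Submodule.ker_mkQ]
  ext m
  simp [Submodule.ideal_span_singleton_smul, Submodule.mem_smul_pointwise_iff_exists]

/-- If `x` is regular on `M`, then `Tor` against `M / xM` vanishes in one degree higher than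
`Tor` against `M`. -/
theorem subsingleton_torMod_quotient_right {R : Type u} [CommRing R] {x : R} {M N : Type u}
    [AddCommGroup M] [Module R M] [AddCommGroup N] [Module R N] (hx : IsSMulRegular M x)
    (h : ∀ n, Subsingleton (torMod R (n + 1) M N)) (n : ℕ) :
    Subsingleton (torMod R (n + 2) N (M ⧸ (Ideal.span {x} • ⊤ : Submodule R M))) := by
  obtain ⟨e⟩ := nonempty_torMod_equiv_of_exact (f := LinearMap.lsmul R M x) hx
    (exact_lsmul_mkQ x) (Submodule.mkQ_surjective _) N n (h (n + 1)) (h n)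
  have := h n
  exact subsingleton_torMod_symm (n + 1) e.toEquiv.subsingleton

theorem subsingleton_torMod_quotient_ring {R : Type u} [CommRing R] {x : R} {N : Type u}
    [AddCommGroup N] [Module R N] (hx : IsSMulRegular R x) (n : ℕ) :
    Subsingleton (torMod R (n + 2) N (R ⧸ Ideal.span {x})) := by
  have h := subsingleton_torMod_quotient_right (N := N) hx
    (fun n => subsingleton_torMod_succ_of_flat n R N) n
  rwa [smul_eq_mul, Ideal.mul_top] at h

/-- for Tor-independent `M, N` and `x ∈ m` regular on `R` and `M`,
an exact sequence
`0 → Tor_2^{R/xR}(N/xN, M/xM) → Tor_1^R(N, R/xR) ⊗_{R/xR} M/xM → Tor_1^R(N, M/xM) →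
Tor_1^{R/xR}(N/xN, M/xM) → 0` and isomorphisms
`Tor_p^{R/xR}(N/xN, M/xM) ≅ Tor_{p-2}^{R/xR}(Tor_1^R(N, R/xR), M/xM)` for `p ≥ 3`. -/
theorem stmt_7 (R : Type u) [CommRing R] [IsNoetherianRing R] [IsLocalRing R]
    (hR : 0 < eDepth R R)
    (M N : Type u) [AddCommGroup M] [Module R M] [AddCommGroup N] [Module R N]
    [Module.Finite R M] [Module.Finite R N] [Nontrivial M] [Nontrivial N]
    (hTI : TorIndep R M N)
    (x : R) (hx : x ∈ IsLocalRing.maximalIdeal R)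
    (hxR : IsSMulRegular R x) (hxM : IsSMulRegular M x)
    [instT : Module (R ⧸ Ideal.span {x}) (torMod R 1 N (R ⧸ Ideal.span {x}))]
    (hcompat : ∀ (r : R) (t : torMod R 1 N (R ⧸ Ideal.span {x})),
      (Ideal.Quotient.mk (Ideal.span {x}) r) • t = r • t) :
    (∃ (f : (torMod (R ⧸ Ideal.span {x}) 2
            (N ⧸ (Ideal.span {x} • ⊤ : Submodule R N))
            (M ⧸ (Ideal.span {x} • ⊤ : Submodule R M))) →+
          (TensorProduct (R ⧸ Ideal.span {x})
            (torMod R 1 N (R ⧸ Ideal.span {x}))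
            (M ⧸ (Ideal.span {x} • ⊤ : Submodule R M))))
      (g : (TensorProduct (R ⧸ Ideal.span {x})
            (torMod R 1 N (R ⧸ Ideal.span {x}))
            (M ⧸ (Ideal.span {x} • ⊤ : Submodule R M))) →+
          (torMod R 1 N (M ⧸ (Ideal.span {x} • ⊤ : Submodule R M))))
      (h : (torMod R 1 N (M ⧸ (Ideal.span {x} • ⊤ : Submodule R M))) →+
          (torMod (R ⧸ Ideal.span {x}) 1
            (N ⧸ (Ideal.span {x} • ⊤ : Submodule R N))
            (M ⧸ (Ideal.span {x} • ⊤ : Submodule R M)))),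
      Function.Injective f ∧ Function.Exact f g ∧ Function.Exact g h ∧
        Function.Surjective h) ∧
    (∀ p : ℕ, Nonempty
      ((torMod (R ⧸ Ideal.span {x}) (p + 3)
          (N ⧸ (Ideal.span {x} • ⊤ : Submodule R N))
          (M ⧸ (Ideal.span {x} • ⊤ : Submodule R M))) ≃+
        (torMod (R ⧸ Ideal.span {x}) (p + 1)
          (torMod R 1 N (R ⧸ Ideal.span {x}))
          (M ⧸ (Ideal.span {x} • ⊤ : Submodule R M))))) := by
  have : IsScalarTower R (R ⧸ Ideal.span {x}) (torMod R 1 N (R ⧸ Ideal.span {x})) :=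
    IsScalarTower.of_algebraMap_smul hcompat
  exact exists_changeOfRings_exact_sequence Ideal.Quotient.mk_surjective
    ((TensorProduct.quotTensorEquivQuotSMul N (Ideal.span {x})).extendScalarsOfSurjective
      Ideal.Quotient.mk_surjective)
    (subsingleton_torMod_quotient_ring hxR)
    (subsingleton_torMod_quotient_right hxM fun n => hTI (n + 1) (Nat.le_add_left 1 n))
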